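/- arXiv:1309.5856 — 2 statements merged into one kernel-verified Lean document; each statement's English description precedes it below -/
import Mathlib

section
/- (KPRGT inequality for ℝ¹.) Let A, B ⊆ ℝ be Lebesgue measurable sets with finite, positive measures and let τ ∈ [0, min(|A|,|B|)]. Then ∫_τ^∞ |S_{A,B}(t)| dt ≤ (|A| − τ)(|B| − τ); equivalently, the KPRGT deficit D′(A,B,τ) is nonnegative. -/
open MeasureTheory Set Pointwise

/-- Lebesgue measure of a set of reals, as a real number. -/
noncomputable def lm (S : Set ℝ) : ℝ := (MeasureTheory.volume S).toReal

/-- Convolution of indicator functions: `(1_A ∗ 1_B)(x) = ∫ 1_A(y) 1_B(x−y) dy`. -/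
noncomputable def cv (A B : Set ℝ) (x : ℝ) : ℝ :=
  ∫ y, A.indicator (1 : ℝ → ℝ) y * B.indicator (1 : ℝ → ℝ) (x - y)

/-- The pairing `⟨1_A ∗ 1_B, 1_C⟩ = ∫ (1_A ∗ 1_B) · 1_C`. -/
noncomputable def pr (A B C : Set ℝ) : ℝ := ∫ x, cv A B x * C.indicator (1 : ℝ → ℝ) x

/-- The symmetric rearrangement `S⋆`: the open interval centered at 0 with `|S⋆| = |S|`. -/
noncomputable def sstar (S : Set ℝ) : Set ℝ := Set.Ioo (-(lm S / 2)) (lm S / 2)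

/-- The Riesz–Sobolev deficit `D(A,B,C) = ⟨1_{A⋆}∗1_{B⋆},1_{C⋆}⟩ − ⟨1_A∗1_B,1_C⟩`. -/
noncomputable def rsD (A B C : Set ℝ) : ℝ := pr (sstar A) (sstar B) (sstar C) - pr A B C

/-- The superlevel set `S_{A,B}(t) = {x : (1_A ∗ 1_B)(x) > t}`. -/
def slev (A B : Set ℝ) (t : ℝ) : Set ℝ := {x | cv A B x > t}

/-- The KPRGT deficit `D′(A,B,τ) = (|A|−τ)(|B|−τ) − ∫_τ^∞ |S_{A,B}(t)| dt`. -/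
noncomputable def kD (A B : Set ℝ) (τ : ℝ) : ℝ :=
  (lm A - τ) * (lm B - τ) - ∫ t in Set.Ioi τ, lm (slev A B t)

/-- `η`-strict admissibility of the ordered triple `(A,B,C)`:
`|X| + |Y| ≥ |Z| + η·max(|A|,|B|,|C|)` for every permutation `(X,Y,Z)` of `(A,B,C)`. -/
def adm (η : ℝ) (A B C : Set ℝ) : Prop :=
  lm A + lm B ≥ lm C + η * max (lm A) (max (lm B) (lm C)) ∧
  lm A + lm C ≥ lm B + η * max (lm A) (max (lm B) (lm C)) ∧
  lm B + lm C ≥ lm A + η * max (lm A) (max (lm B) (lm C))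

lemma exists_isLowerSet_volume_inter_eq {A : Set ℝ} (hAf : volume A ≠ ⊤) {τ : ℝ}
    (hτ0 : 0 ≤ τ) (hτ : τ ≤ volume.real A) :
    ∃ I : Set ℝ, IsLowerSet I ∧ volume.real (A ∩ I) = τ := by
  rcases hτ0.eq_or_lt with rfl | h0
  · exact ⟨∅, isLowerSet_empty, by simp⟩
  rcases hτ.eq_or_lt with rfl | h1
  · exact ⟨univ, isLowerSet_univ, by simp⟩
  have : IsFiniteMeasure (volume.restrict A) := isFiniteMeasure_restrict.2 hAf
  have hF (p : ℝ) : (volume.restrict A).real (Iic p) = volume.real (A ∩ Iic p) := by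
    rw [measureReal_restrict_apply measurableSet_Iic, inter_comm]
  have hcont : Continuous fun p : ℝ => volume.real (A ∩ Iic p) := by
    refine (LipschitzWith.of_le_add fun p q => ?_).continuous
    have hsub : A ∩ Iic p ⊆ (A ∩ Iic q) ∪ uIcc q p := by
      rintro a ⟨ha, hap⟩
      rcases le_or_gt a q with h | h
      · exact .inl ⟨ha, h⟩
      · exact .inr ⟨inf_le_left.trans h.le, le_trans hap le_sup_right⟩
    refine (measureReal_mono hsub (measure_union_lt_top
      (measure_lt_top_of_subset inter_subset_left hAf)
      isCompact_uIcc.measure_lt_top).ne).trans ((measureReal_union_le _ _).trans ?_)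
    gcongr
    rw [measureReal_def, Real.volume_interval, ENNReal.toReal_ofReal (abs_nonneg _), Real.dist_eq]
  have hbot : Filter.Tendsto (fun p : ℝ => volume.real (A ∩ Iic p)) Filter.atBot (nhds 0) := by
    simp only [← hF]
    have h := tendsto_measure_iInter_atBot (μ := volume.restrict A) (s := fun p : ℝ => Iic p)
      (fun p => measurableSet_Iic.nullMeasurableSet) (fun p q hpq => Iic_subset_Iic.2 hpq)
      ⟨0, measure_ne_top _ _⟩
    rw [iInter_Iic_eq_empty_iff.2 (by simp), measure_empty] at h
    exact (ENNReal.tendsto_toReal ENNReal.zero_ne_top).comp h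
  have htop : Filter.Tendsto (fun p : ℝ => volume.real (A ∩ Iic p)) Filter.atTop
      (nhds (volume.real A)) := by
    simp only [← hF]
    have h := (ENNReal.tendsto_toReal (measure_ne_top _ _)).comp
      (tendsto_measure_Iic_atTop (volume.restrict A))
    rwa [Measure.restrict_apply_univ] at h
  obtain ⟨p, hp⟩ := mem_range_of_exists_le_of_exists_ge hcont
    ((hbot.eventually_lt_const h0).exists.imp fun _ h => h.le)
    ((htop.eventually_const_lt h1).exists.imp fun _ h => h.le)
  exact ⟨Iic p, isLowerSet_Iic p, hp⟩

lemma volume_real_preimage_neg (S : Set ℝ) : volume.real (Neg.neg ⁻¹' S) = volume.real S := by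
  rw [measureReal_def, Measure.measure_preimage_neg, measureReal_def]

lemma exists_isUpperSet_volume_inter_eq {B : Set ℝ} (hBf : volume B ≠ ⊤) {τ : ℝ}
    (hτ0 : 0 ≤ τ) (hτ : τ ≤ volume.real B) :
    ∃ J : Set ℝ, IsUpperSet J ∧ volume.real (B ∩ J) = τ := by
  obtain ⟨I, hI, hIτ⟩ := exists_isLowerSet_volume_inter_eq (A := Neg.neg ⁻¹' B)
    (by rwa [Measure.measure_preimage_neg]) hτ0 (by rwa [volume_real_preimage_neg])
  refine ⟨Neg.neg ⁻¹' I, fun a b hab ha => hI (neg_le_neg hab) ha, ?_⟩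
  rw [← hIτ, ← volume_real_preimage_neg (B ∩ _)]
  congr 1
  ext x
  simp

lemma volume_preimage_sub_left (B : Set ℝ) (x : ℝ) :
    volume ((fun y => x - y) ⁻¹' B) = volume B := by
  simp_rw [sub_eq_add_neg]
  rw [show (fun y => x + -y) ⁻¹' B = Neg.neg ⁻¹' ((fun y => x + y) ⁻¹' B) from rfl,
    Measure.measure_preimage_neg, measure_preimage_add]

lemma cv_eq_volume_real {A B : Set ℝ} (hA : MeasurableSet A) (hB : MeasurableSet B) (x : ℝ) :
    cv A B x = volume.real (A ∩ (fun y => x - y) ⁻¹' B) := by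
  have hm : MeasurableSet (A ∩ (fun y => x - y) ⁻¹' B) :=
    hA.inter ((measurable_const.sub measurable_id) hB)
  rw [cv, ← integral_indicator_one hm]
  congr 1
  ext y
  by_cases h1 : y ∈ A <;> by_cases h2 : x - y ∈ B <;> simp [h1, h2, indicator]

lemma cv_eq_convolution (A B : Set ℝ) :
    cv A B = convolution (A.indicator (1 : ℝ → ℝ)) (B.indicator (1 : ℝ → ℝ))
      (ContinuousLinearMap.mul ℝ ℝ) volume := by
  ext x
  simp [cv, convolution]

lemma integrable_indicator_one {A : Set ℝ} (hA : MeasurableSet A) (hAf : volume A ≠ ⊤) :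
    Integrable (A.indicator (1 : ℝ → ℝ)) volume :=
  (integrable_indicator_iff hA).2 (integrableOn_const hAf)

lemma integrable_cv {A B : Set ℝ} (hA : MeasurableSet A) (hB : MeasurableSet B)
    (hAf : volume A ≠ ⊤) (hBf : volume B ≠ ⊤) : Integrable (cv A B) volume := by
  rw [cv_eq_convolution]
  exact (integrable_indicator_one hA hAf).integrable_convolution _
    (integrable_indicator_one hB hBf)

lemma integral_cv {A B : Set ℝ} (hA : MeasurableSet A) (hB : MeasurableSet B)
    (hAf : volume A ≠ ⊤) (hBf : volume B ≠ ⊤) :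
    ∫ x, cv A B x = volume.real A * volume.real B := by
  rw [cv_eq_convolution, integral_convolution _ (integrable_indicator_one hA hAf)
    (integrable_indicator_one hB hBf), integral_indicator_one hA, integral_indicator_one hB]
  simp

/-- Removing a lower part of `A` and an upper part of `B`, each of measure at most `τ`, lowers the
convolution by at most `τ`: the discarded `y` lie in the larger of two nested lower sets. -/
lemma cv_le_add_cv_diff {A B I J : Set ℝ} (hA : MeasurableSet A) (hB : MeasurableSet B)
    (hAf : volume A ≠ ⊤) (hBf : volume B ≠ ⊤) (hI : IsLowerSet I) (hJ : IsUpperSet J) {τ : ℝ}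
    (hAI : volume.real (A ∩ I) ≤ τ) (hBJ : volume.real (B ∩ J) ≤ τ) (x : ℝ) :
    cv A B x ≤ τ + cv (A \ I) (B \ J) x := by
  rw [cv_eq_volume_real hA hB, cv_eq_volume_real (hA.diff hI.ordConnected.measurableSet)
    (hB.diff hJ.ordConnected.measurableSet)]
  set K : Set ℝ := (fun y => x - y) ⁻¹' J
  have hKl : IsLowerSet K := fun a b hab ha => hJ (sub_le_sub_left hab x) ha
  have hsub : A ∩ (fun y => x - y) ⁻¹' B ⊆ (A ∩ (fun y => x - y) ⁻¹' B ∩ (I ∪ K)) ∪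
      ((A \ I) ∩ (fun y => x - y) ⁻¹' (B \ J)) := by
    rintro y ⟨hyA, hyB⟩
    by_cases hy : y ∈ I ∪ K
    · exact .inl ⟨⟨hyA, hyB⟩, hy⟩
    · exact .inr ⟨⟨hyA, fun h => hy (.inl h)⟩, hyB, fun h => hy (.inr h)⟩
  have hfin {S : Set ℝ} (hS : S ⊆ A) : volume S < ⊤ := measure_lt_top_of_subset hS hAf
  refine (measureReal_mono hsub (measure_union_lt_top
    (hfin (inter_subset_left.trans inter_subset_left))
    (hfin (inter_subset_left.trans sdiff_subset))).ne).trans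
    ((measureReal_union_le _ _).trans ?_)
  gcongr
  rcases hI.total hKl with h | h
  · rw [union_eq_self_of_subset_left h]
    refine le_trans ?_ hBJ
    rw [measureReal_def (s := B ∩ J), ← volume_preimage_sub_left (B ∩ J) x]
    refine ENNReal.toReal_mono ?_ (measure_mono fun y hy => ⟨hy.1.2, hy.2⟩)
    rw [volume_preimage_sub_left]
    exact (measure_lt_top_of_subset inter_subset_left hBf).ne
  · rw [union_eq_self_of_subset_right h]
    refine le_trans (measureReal_mono ?_ (hfin inter_subset_left).ne) hAI
    exact inter_subset_inter_left _ inter_subset_left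

/-- The KPRGT inequality for ℝ¹. -/
theorem kprgt_inequality (A B : Set ℝ)
    (hA : MeasurableSet A) (hB : MeasurableSet B)
    (hA0 : 0 < volume A) (hAf : volume A ≠ ⊤)
    (hB0 : 0 < volume B) (hBf : volume B ≠ ⊤)
    (τ : ℝ) (hτ0 : 0 ≤ τ) (hτ : τ ≤ min (lm A) (lm B)) :
    (∫ t in Set.Ioi τ, lm (slev A B t)) ≤ (lm A - τ) * (lm B - τ) := by
  obtain ⟨I, hI, hAI⟩ := exists_isLowerSet_volume_inter_eq hAf hτ0 (hτ.trans (min_le_left _ _))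
  obtain ⟨J, hJ, hBJ⟩ := exists_isUpperSet_volume_inter_eq hBf hτ0 (hτ.trans (min_le_right _ _))
  have hIm := hI.ordConnected.measurableSet
  have hJm := hJ.ordConnected.measurableSet
  have hA'f : volume (A \ I) ≠ ⊤ := (measure_lt_top_of_subset sdiff_subset hAf).ne
  have hB'f : volume (B \ J) ≠ ⊤ := (measure_lt_top_of_subset sdiff_subset hBf).ne
  have hint' := integrable_cv (hA.diff hIm) (hB.diff hJm) hA'f hB'f
  have hle (x : ℝ) : max (cv A B x - τ) 0 ≤ cv (A \ I) (B \ J) x := by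
    refine max_le ?_ ?_
    · linarith [cv_le_add_cv_diff hA hB hAf hBf hI hJ hAI.le hBJ.le x]
    · rw [cv_eq_volume_real (hA.diff hIm) (hB.diff hJm)]
      exact measureReal_nonneg
  have hint : Integrable (fun x => max (cv A B x - τ) 0) volume := by
    refine hint'.mono' (((integrable_cv hA hB hAf hBf).aestronglyMeasurable.sub
      aestronglyMeasurable_const).sup aestronglyMeasurable_const) (.of_forall fun x => ?_)
    rw [Real.norm_of_nonneg (le_max_right _ _)]
    exact hle x
  calc ∫ t in Ioi τ, lm (slev A B t)
      = ∫ t in Ioi 0, lm (slev A B (t + τ)) := by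
        rw [← (measurePreserving_add_right volume τ).setIntegral_preimage_emb
          (MeasurableEquiv.addRight τ).measurableEmbedding, preimage_add_const_Ioi, sub_self]
    _ = ∫ t in Ioi 0, volume.real {x | t < max (cv A B x - τ) 0} := by
        refine setIntegral_congr_fun measurableSet_Ioi fun t (ht : 0 < t) => ?_
        simp only [lm, slev, measureReal_def, lt_max_iff, ht.not_gt, or_false, gt_iff_lt,
          lt_sub_iff_add_lt]
    _ = ∫ x, max (cv A B x - τ) 0 :=
        (hint.integral_eq_integral_meas_lt (.of_forall fun _ => le_max_right _ _)).symm
    _ ≤ ∫ x, cv (A \ I) (B \ J) x := integral_mono hint hint' hle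
    _ = (lm A - τ) * (lm B - τ) := by
        rw [integral_cv (hA.diff hIm) (hB.diff hJm) hA'f hB'f]
        congr 1
        · linarith [measureReal_inter_add_sdiff (s := A) hIm hAf, show lm A = volume.real A from rfl]
        · linarith [measureReal_inter_add_sdiff (s := B) hJm hBf, show lm B = volume.real B from rfl]
end

section
/- Let A, B, C ⊆ ℝ be Lebesgue measurable sets with finite, positive Lebesgue measures, and let η, η′ > 0 satisfy η + η′ < min(|A|,|B|). Then ⟨1_A∗1_B, 1_C⟩ ≤ ⟨1_{A_{η,η′}}∗1_{B_{η′,η}}, 1_C⟩ + (η + η′)|C|. -/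
open MeasureTheory Set Pointwise

/-- The truncation `S_{η,η′} = S ∩ [a,b]`, where `a` is the smallest real with
`|S ∩ (−∞,a)| = η` (no lower truncation when `η = 0`) and `b` is the largest real
with `|S ∩ (b,∞)| = η′` (no upper truncation when `η′ = 0`). -/
noncomputable def trunc (S : Set ℝ) (η ηp : ℝ) : Set ℝ :=
  S ∩ (if η = 0 then Set.univ
        else Set.Ici (sInf {a : ℝ | lm (S ∩ Set.Iio a) = η}))
    ∩ (if ηp = 0 then Set.univ
        else Set.Iic (sSup {b : ℝ | lm (S ∩ Set.Ioi b) = ηp}))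


lemma lm_eq_volume_real (S : Set ℝ) : lm S = volume.real S := rfl

lemma lm_mono {S T : Set ℝ} (h : S ⊆ T) (hT : volume T ≠ ⊤) : lm S ≤ lm T :=
  measureReal_mono h hT

lemma lm_neg (S : Set ℝ) : lm (-S) = lm S := by
  rw [lm, lm, Measure.measure_neg]

lemma lm_preimage_sub_left (S : Set ℝ) (x : ℝ) : lm ((fun y => x - y) ⁻¹' S) = lm S := by
  have h : (fun y => x - y) ⁻¹' S = -((fun y => x + y) ⁻¹' S) := by
    ext y
    simp [sub_eq_add_neg]
  rw [h, lm_neg, lm, lm, measure_preimage_add]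

lemma monotone_lm_inter_Iio {S : Set ℝ} (hS : volume S ≠ ⊤) :
    Monotone fun a => lm (S ∩ Iio a) := fun _ _ hab =>
  lm_mono (inter_subset_inter_right _ (Iio_subset_Iio hab))
    (measure_ne_top_of_subset inter_subset_left hS)

lemma continuous_lm_inter_Iio {S : Set ℝ} (hS : volume S ≠ ⊤) :
    Continuous fun a => lm (S ∩ Iio a) := by
  refine (LipschitzWith.of_le_add fun x y => ?_).continuous
  have hy : volume (S ∩ Iio y) ≠ ⊤ := measure_ne_top_of_subset inter_subset_left hS
  have hsub : S ∩ Iio x ⊆ (S ∩ Iio y) ∪ Ico y x := by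
    rintro z ⟨hz, hzx⟩
    rcases lt_or_ge z y with h | h
    · exact Or.inl ⟨hz, h⟩
    · exact Or.inr ⟨h, hzx⟩
  calc lm (S ∩ Iio x) ≤ lm ((S ∩ Iio y) ∪ Ico y x) :=
        lm_mono hsub (measure_union_ne_top hy (by simp))
    _ ≤ lm (S ∩ Iio y) + lm (Ico y x) := measureReal_union_le _ _
    _ ≤ lm (S ∩ Iio y) + dist x y := by
        gcongr
        rw [lm_eq_volume_real, measureReal_def, Real.volume_Ico, ENNReal.toReal_ofReal',
          Real.dist_eq]
        exact max_le (le_abs_self _) (abs_nonneg _)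

lemma tendsto_lm_inter_Iio_atTop {S : Set ℝ} (hS : volume S ≠ ⊤) :
    Filter.Tendsto (fun a => lm (S ∩ Iio a)) Filter.atTop (nhds (lm S)) := by
  refine (ENNReal.tendsto_toReal hS).comp ?_
  have h := tendsto_measure_iUnion_atTop (μ := volume) (s := fun a : ℝ => S ∩ Iio a)
    fun _ _ hab => inter_subset_inter_right _ (Iio_subset_Iio hab)
  rwa [← inter_iUnion, iUnion_Iio, inter_univ] at h

lemma tendsto_lm_inter_Iio_atBot {S : Set ℝ} (hSm : MeasurableSet S) (hS : volume S ≠ ⊤) :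
    Filter.Tendsto (fun a => lm (S ∩ Iio a)) Filter.atBot (nhds 0) := by
  have h := tendsto_measure_iInter_atBot (μ := volume) (s := fun a : ℝ => S ∩ Iio a)
    (fun _ => (hSm.inter measurableSet_Iio).nullMeasurableSet)
    (fun _ _ hab => inter_subset_inter_right _ (Iio_subset_Iio hab))
    ⟨0, measure_ne_top_of_subset inter_subset_left hS⟩
  have h0 : ⋂ a : ℝ, S ∩ Iio a = ∅ := by
    refine eq_empty_of_forall_notMem fun y hy => ?_
    exact lt_irrefl y (mem_iInter.1 hy y).2
  rw [h0, measure_empty] at h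
  exact (ENNReal.tendsto_toReal ENNReal.zero_ne_top).comp h

lemma lm_inter_Iio_sInf_le {S : Set ℝ} (hSm : MeasurableSet S) (hS : volume S ≠ ⊤)
    {η : ℝ} (hη : 0 < η) (hηS : η < lm S) :
    lm (S ∩ Iio (sInf {a : ℝ | lm (S ∩ Iio a) = η})) ≤ η := by
  obtain ⟨u, hu⟩ := ((tendsto_lm_inter_Iio_atBot hSm hS).eventually_lt_const hη).exists
  obtain ⟨v, hv⟩ := ((tendsto_lm_inter_Iio_atTop hS).eventually_const_lt hηS).exists
  obtain ⟨a, ha⟩ := mem_range_of_exists_le_of_exists_ge (continuous_lm_inter_Iio hS)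
    ⟨u, hu.le⟩ ⟨v, hv.le⟩
  have hbdd : BddBelow {a : ℝ | lm (S ∩ Iio a) = η} := by
    refine ⟨u, fun b hb => ?_⟩
    by_contra! hbu
    have hle : lm (S ∩ Iio b) ≤ lm (S ∩ Iio u) := monotone_lm_inter_Iio hS hbu.le
    exact absurd hu (not_lt.2 (hb.symm.le.trans hle))
  exact (monotone_lm_inter_Iio hS (csInf_le hbdd ha)).trans ha.le

lemma lm_inter_Ioi_eq_neg (S : Set ℝ) (b : ℝ) : lm (S ∩ Ioi b) = lm (-S ∩ Iio (-b)) := by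
  rw [← lm_neg, inter_neg, neg_Ioi]

lemma lm_inter_Ioi_sSup_le {S : Set ℝ} (hSm : MeasurableSet S) (hS : volume S ≠ ⊤)
    {η : ℝ} (hη : 0 < η) (hηS : η < lm S) :
    lm (S ∩ Ioi (sSup {b : ℝ | lm (S ∩ Ioi b) = η})) ≤ η := by
  have hset : {b : ℝ | lm (S ∩ Ioi b) = η} = -{a : ℝ | lm (-S ∩ Iio a) = η} := by
    ext b
    simp [lm_inter_Ioi_eq_neg]
  rw [lm_inter_Ioi_eq_neg, hset, Real.sSup_neg, neg_neg]
  exact lm_inter_Iio_sInf_le hSm.neg (by rwa [Measure.measure_neg]) hη (by rwa [lm_neg])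

/-- Truncation at positive levels cuts with a closed interval, outside of which at most the
prescribed mass lies on each side. -/
lemma exists_trunc_eq {S : Set ℝ} (hSm : MeasurableSet S) (hS : volume S ≠ ⊤)
    {η η' : ℝ} (hη : 0 < η) (hη' : 0 < η') (hsum : η + η' < lm S) :
    ∃ a b, trunc S η η' = S ∩ Ici a ∩ Iic b ∧ lm (S ∩ Iio a) ≤ η ∧ lm (S ∩ Ioi b) ≤ η' :=
  ⟨_, _, by rw [trunc, if_neg hη.ne', if_neg hη'.ne'],
    lm_inter_Iio_sInf_le hSm hS hη (by linarith),
    lm_inter_Ioi_sSup_le hSm hS hη' (by linarith)⟩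

lemma measurable_const_sub_real (x : ℝ) : Measurable fun y : ℝ => x - y := by fun_prop

lemma cv_eq_lm {A B : Set ℝ} (hA : MeasurableSet A) (hB : MeasurableSet B) (x : ℝ) :
    cv A B x = lm (A ∩ (fun y => x - y) ⁻¹' B) := by
  have h : (fun y => A.indicator (1 : ℝ → ℝ) y * B.indicator (1 : ℝ → ℝ) (x - y)) =
      (A ∩ (fun y => x - y) ⁻¹' B).indicator 1 := by
    ext y
    by_cases h1 : y ∈ A <;> by_cases h2 : x - y ∈ B <;> simp [indicator, h1, h2]
  rw [cv, h, integral_indicator_one (hA.inter (measurable_const_sub_real x hB)),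
    lm_eq_volume_real]

lemma stronglyMeasurable_cv {A B : Set ℝ} (hA : MeasurableSet A) (hB : MeasurableSet B) :
    StronglyMeasurable (cv A B) := by
  have hm : Measurable fun p : ℝ × ℝ =>
      A.indicator (1 : ℝ → ℝ) p.2 * B.indicator (1 : ℝ → ℝ) (p.1 - p.2) :=
    ((measurable_one.indicator hA).comp measurable_snd).mul
      ((measurable_one.indicator hB).comp (measurable_fst.sub measurable_snd))
  exact hm.stronglyMeasurable.integral_prod_right'

lemma integrableOn_cv {A B C : Set ℝ} (hA : MeasurableSet A) (hB : MeasurableSet B)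
    (hAf : volume A ≠ ⊤) (hCf : volume C ≠ ⊤) : IntegrableOn (cv A B) C := by
  refine Measure.integrableOn_of_bounded (M := lm A) hCf
    (stronglyMeasurable_cv hA hB).aestronglyMeasurable (Filter.Eventually.of_forall fun x => ?_)
  rw [cv_eq_lm hA hB, lm_eq_volume_real, Real.norm_of_nonneg measureReal_nonneg]
  exact lm_mono inter_subset_left hAf

lemma pr_eq_setIntegral (A B : Set ℝ) {C : Set ℝ} (hC : MeasurableSet C) :
    pr A B C = ∫ x in C, cv A B x := by
  rw [pr, ← integral_indicator hC]
  congr 1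
  ext x
  by_cases h : x ∈ C <;> simp [h]

/-- Cutting `A` to `[a, b]` and `B` to `[c, d]` lowers the convolution pointwise by at most
the common bound of the masses of `A` left of `a` and `B` right of `d`, plus the common bound
of the masses of `A` right of `b` and `B` left of `c`. -/
lemma cv_le_cv_inter_add {A B : Set ℝ} (hA : MeasurableSet A) (hB : MeasurableSet B)
    (hAf : volume A ≠ ⊤) (hBf : volume B ≠ ⊤) {a b c d η η' : ℝ}
    (ha : lm (A ∩ Iio a) ≤ η) (hb : lm (A ∩ Ioi b) ≤ η')
    (hc : lm (B ∩ Iio c) ≤ η') (hd : lm (B ∩ Ioi d) ≤ η) (x : ℝ) :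
    cv A B x ≤ cv (A ∩ Ici a ∩ Iic b) (B ∩ Ici c ∩ Iic d) x + (η + η') := by
  rw [cv_eq_lm hA hB, cv_eq_lm ((hA.inter measurableSet_Ici).inter measurableSet_Iic)
    ((hB.inter measurableSet_Ici).inter measurableSet_Iic)]
  set E := A ∩ (fun y => x - y) ⁻¹' B with hE
  set F := (A ∩ Ici a ∩ Iic b) ∩ (fun y => x - y) ⁻¹' (B ∩ Ici c ∩ Iic d) with hF
  have hfin : ∀ {T : Set ℝ}, T ⊆ A → volume T ≠ ⊤ := fun h => measure_ne_top_of_subset h hAf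
  have hreflect : ∀ {T : Set ℝ} {δ : ℝ}, T ⊆ B → lm T ≤ δ →
      lm (A ∩ (fun y => x - y) ⁻¹' T) ≤ δ := fun {T δ} hT h => by
    rw [← lm_preimage_sub_left T x] at h
    refine (lm_mono inter_subset_right fun htop => ?_).trans h
    rw [(Measure.measurePreserving_sub_left volume x).measure_preimage_emb
        (MeasurableEquiv.subLeft x).measurableEmbedding] at htop
    exact measure_ne_top_of_subset hT hBf htop
  have hlow : lm (E ∩ Iio (max a (x - d))) ≤ η := by
    rcases le_total (x - d) a with h | h
    · rw [max_eq_left h]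
      exact (lm_mono (inter_subset_inter_left _ inter_subset_left)
        (hfin inter_subset_left)).trans ha
    · rw [max_eq_right h]
      refine (lm_mono ?_ (hfin inter_subset_left)).trans (hreflect inter_subset_left hd)
      rintro y ⟨⟨hyA, hyB⟩, hy⟩
      exact ⟨hyA, hyB, show d < x - y from lt_sub_comm.1 hy⟩
  have hupp : lm (E ∩ Ioi (min b (x - c))) ≤ η' := by
    rcases le_total b (x - c) with h | h
    · rw [min_eq_left h]
      exact (lm_mono (inter_subset_inter_left _ inter_subset_left)
        (hfin inter_subset_left)).trans hb
    · rw [min_eq_right h]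
      refine (lm_mono ?_ (hfin inter_subset_left)).trans (hreflect inter_subset_left hc)
      rintro y ⟨⟨hyA, hyB⟩, hy⟩
      exact ⟨hyA, hyB, show x - y < c from sub_lt_comm.1 hy⟩
  have hcover : E ⊆ F ∪ (E ∩ Iio (max a (x - d)) ∪ E ∩ Ioi (min b (x - c))) := by
    intro y hy
    by_cases h1 : y < max a (x - d)
    · exact Or.inr (Or.inl ⟨hy, h1⟩)
    by_cases h2 : min b (x - c) < y
    · exact Or.inr (Or.inr ⟨hy, h2⟩)
    obtain ⟨h1a, h1d⟩ := max_le_iff.1 (not_lt.1 h1)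
    obtain ⟨h2b, h2c⟩ := le_min_iff.1 (not_lt.1 h2)
    exact Or.inl ⟨⟨⟨hy.1, h1a⟩, h2b⟩, ⟨hy.2, le_sub_comm.1 h2c⟩, sub_le_comm.1 h1d⟩
  have hEA : E ⊆ A := inter_subset_left
  have hFA : F ⊆ A := fun y hy => hy.1.1.1
  calc lm E ≤ lm (F ∪ (E ∩ Iio (max a (x - d)) ∪ E ∩ Ioi (min b (x - c)))) :=
        lm_mono hcover (hfin (union_subset hFA (union_subset (inter_subset_left.trans hEA)
          (inter_subset_left.trans hEA))))
    _ ≤ lm F + lm (E ∩ Iio (max a (x - d)) ∪ E ∩ Ioi (min b (x - c))) :=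
        measureReal_union_le _ _
    _ ≤ lm F + (lm (E ∩ Iio (max a (x - d))) + lm (E ∩ Ioi (min b (x - c)))) := by
        gcongr
        exact measureReal_union_le _ _
    _ ≤ lm F + (η + η') := by gcongr

/-- Truncation lemma: the pairing decreases by at most `(η+η′)|C|` under
the pair of truncations `A ↦ A_{η,η′}`, `B ↦ B_{η′,η}`. -/
theorem truncation_pairing_bound (A B C : Set ℝ)
    (hA : MeasurableSet A) (hB : MeasurableSet B) (hC : MeasurableSet C)
    (hA0 : 0 < volume A) (hAf : volume A ≠ ⊤)
    (hB0 : 0 < volume B) (hBf : volume B ≠ ⊤)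
    (hC0 : 0 < volume C) (hCf : volume C ≠ ⊤)
    (η η' : ℝ) (hη : 0 < η) (hη' : 0 < η')
    (hsum : η + η' < min (lm A) (lm B)) :
    pr A B C ≤ pr (trunc A η η') (trunc B η' η) C + (η + η') * lm C := by
  obtain ⟨a, b, hAt, ha, hb⟩ := exists_trunc_eq hA hAf hη hη' (hsum.trans_le (min_le_left _ _))
  obtain ⟨c, d, hBt, hc, hd⟩ := exists_trunc_eq hB hBf hη' hη
    (by rw [add_comm]; exact hsum.trans_le (min_le_right _ _))
  have hint := integrableOn_cv (C := C) ((hA.inter measurableSet_Ici).inter measurableSet_Iic)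
    ((hB.inter measurableSet_Ici).inter measurableSet_Iic)
    (measure_ne_top_of_subset (inter_subset_left.trans inter_subset_left) hAf) hCf
    (A := A ∩ Ici a ∩ Iic b) (B := B ∩ Ici c ∩ Iic d)
  have hconst : IntegrableOn (fun _ : ℝ => η + η') C := integrableOn_const hCf
  rw [hAt, hBt, pr_eq_setIntegral _ _ hC, pr_eq_setIntegral _ _ hC]
  calc ∫ x in C, cv A B x
      ≤ ∫ x in C, (cv (A ∩ Ici a ∩ Iic b) (B ∩ Ici c ∩ Iic d) x + (η + η')) :=
        setIntegral_mono (integrableOn_cv hA hB hAf hCf) (hint.add hconst)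
          (cv_le_cv_inter_add hA hB hAf hBf ha hb hc hd)
    _ = _ := by
        rw [integral_add hint hconst, setIntegral_const, smul_eq_mul, mul_comm, lm_eq_volume_real]
end
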